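/- arXiv:1505.02451 — 2 statements merged into one kernel-verified Lean document; each statement's English description precedes it below -/
import Mathlib

section
/- (Stability of invariant measures under kernel perturbation.) Let K be a Markov kernel on M with unique invariant probability measure μ, geometrically ergodic with rate κ ∈ (0,1): sup_x ‖δ_x K^n − μ‖_TV = O(κ^n). Let {K_ε} be a family of Markov kernels with sup_{|f|≤1} ‖K_ε f − K f‖_∞ → 0 as ε → 0. Then for every κ̂ ∈ (κ,1) there exists δ > 0 such that for ε < δ, K_ε has a unique invariant probability measure μ_ε, sup_{ε<δ} sup_x ‖δ_x K_ε^n − μ_ε‖_TV = O(κ̂^n), and ‖μ_ε − μ‖_TV → 0 as ε → 0. -/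
open MeasureTheory ProbabilityTheory Filter Set

/-- `n`-step distributions: `iterateK K ξ n = ξ K^n`. -/
noncomputable def iterateK {M : Type*} [MeasurableSpace M]
    (K : ProbabilityTheory.Kernel M M) (ξ : Measure M) : ℕ → Measure M
  | 0 => ξ
  | n + 1 => (iterateK K ξ n).bind K

/-- Total variation norm of a difference of measures,
`‖μ − ν‖_TV = sup_{|f| ≤ 1} |∫ f dμ − ∫ f dν|`. -/
noncomputable def tvDist {M : Type*} [MeasurableSpace M] (μ ν : Measure M) : ℝ :=
  ⨆ f : {f : M → ℝ // Measurable f ∧ ∀ x, |f x| ≤ 1},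
    |∫ x, f.1 x ∂μ - ∫ x, f.1 x ∂ν|

open scoped Topology ENNReal

/-- Measurable functions bounded by one. -/
def UB {M : Type*} [MeasurableSpace M] (f : M → ℝ) : Prop := Measurable f ∧ ∀ x, |f x| ≤ 1

/-- The transition operator acting on functions. -/
noncomputable def opT {M : Type*} [MeasurableSpace M] (K : Kernel M M) (f : M → ℝ) : M → ℝ :=
  fun x => ∫ y, f y ∂(K x)

section helpers
variable {M : Type*} [MeasurableSpace M]

lemma UB.integrable {f : M → ℝ} (hf : UB f) (ξ : Measure M) [IsFiniteMeasure ξ] :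
    Integrable f ξ :=
  Integrable.of_bound hf.1.aestronglyMeasurable 1 (ae_of_all _ hf.2)

lemma abs_integral_sub_le {g : M → ℝ} (ξ : Measure M) [IsProbabilityMeasure ξ]
    (hg : Integrable g ξ) (c a : ℝ) (h : ∀ x, |g x - c| ≤ a) : |∫ x, g x ∂ξ - c| ≤ a := by
  have h1 : ∫ x, g x ∂ξ - c = ∫ x, (g x - c) ∂ξ := by
    rw [integral_sub hg (integrable_const c)]; simp
  rw [h1]
  have := norm_integral_le_of_norm_le_const (μ := ξ) (f := fun x => g x - c) (C := a)
    (ae_of_all _ h)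
  simpa using this

lemma abs_integral_sub_integral_le {g : M → ℝ} (ξ ξ' : Measure M) [IsProbabilityMeasure ξ]
    [IsProbabilityMeasure ξ'] (hg : Integrable g ξ) (hg' : Integrable g ξ') (a : ℝ)
    (h : ∀ x y, |g x - g y| ≤ a) : |∫ x, g x ∂ξ - ∫ x, g x ∂ξ'| ≤ a := by
  apply abs_integral_sub_le ξ hg
  intro x
  rw [abs_sub_comm]
  exact abs_integral_sub_le ξ' hg' _ _ fun y => h y x

lemma UB.abs_integral_le {f : M → ℝ} (hf : UB f) (ξ : Measure M) [IsProbabilityMeasure ξ] :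
    |∫ x, f x ∂ξ| ≤ 1 := by
  simpa using abs_integral_sub_le ξ (hf.integrable ξ) 0 1 (by simpa using hf.2)

lemma UB.opT {f : M → ℝ} (hf : UB f) (K : Kernel M M) [IsMarkovKernel K] : UB (opT K f) :=
  ⟨(StronglyMeasurable.integral_kernel hf.1.stronglyMeasurable).measurable,
    fun x => hf.abs_integral_le (K x)⟩

lemma UB.iter {f : M → ℝ} (hf : UB f) (K : Kernel M M) [IsMarkovKernel K] (n : ℕ) :
    UB ((_root_.opT K)^[n] f) := by
  induction n with
  | zero => exact hf
  | succ n ih => rw [Function.iterate_succ_apply']; exact ih.opT K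

instance bind_prob (ξ : Measure M) [IsProbabilityMeasure ξ] (K : Kernel M M) [IsMarkovKernel K] :
    IsProbabilityMeasure (ξ.bind K) := inferInstance

lemma integral_bind_opT {f : M → ℝ} (hf : UB f) (ξ : Measure M) [IsProbabilityMeasure ξ]
    (K : Kernel M M) [IsMarkovKernel K] : ∫ x, f x ∂(ξ.bind K) = ∫ x, opT K f x ∂ξ := by
  have := Kernel.integral_comp (η := K) (κ := Kernel.const Unit ξ) (a := ()) (f := f)
    (hf.integrable _)
  simpa [Kernel.comp_apply, opT] using this

instance iterateK_prob (ξ : Measure M) [IsProbabilityMeasure ξ] (K : Kernel M M)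
    [IsMarkovKernel K] (n : ℕ) : IsProbabilityMeasure (iterateK K ξ n) := by
  induction n with
  | zero => simpa [iterateK]
  | succ n ih => rw [iterateK]; infer_instance

lemma integral_iterateK {f : M → ℝ} (hf : UB f) (ξ : Measure M) [IsProbabilityMeasure ξ]
    (K : Kernel M M) [IsMarkovKernel K] (n : ℕ) :
    ∫ x, f x ∂(iterateK K ξ n) = ∫ x, (opT K)^[n] f x ∂ξ := by
  induction n generalizing f with
  | zero => simp [iterateK]
  | succ n ih =>
    rw [iterateK, integral_bind_opT hf, ih (hf.opT K), Function.iterate_succ_apply]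

lemma integral_iterateK_dirac {f : M → ℝ} (hf : UB f) (x : M)
    (K : Kernel M M) [IsMarkovKernel K] (n : ℕ) :
    ∫ x, f x ∂(iterateK K (Measure.dirac x) n) = (opT K)^[n] f x := by
  rw [integral_iterateK hf, integral_dirac' _ _ (hf.iter K n).1.stronglyMeasurable]

lemma integral_inv_iter {f : M → ℝ} (hf : UB f) (m : Measure M) [IsProbabilityMeasure m]
    (K : Kernel M M) [IsMarkovKernel K] (hm : m.bind K = m) (n : ℕ) :
    ∫ x, (opT K)^[n] f x ∂m = ∫ x, f x ∂m := by
  induction n with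
  | zero => rfl
  | succ n ih =>
    rw [Function.iterate_succ_apply', ← integral_bind_opT (hf.iter K n), hm, ih]

lemma le_tvDist (ξ ξ' : Measure M) [IsProbabilityMeasure ξ] [IsProbabilityMeasure ξ']
    {f : M → ℝ} (hf : UB f) : |∫ x, f x ∂ξ - ∫ x, f x ∂ξ'| ≤ tvDist ξ ξ' := by
  refine le_ciSup (f := fun f : {f : M → ℝ // Measurable f ∧ ∀ x, |f x| ≤ 1} =>
    |∫ x, f.1 x ∂ξ - ∫ x, f.1 x ∂ξ'|) ⟨2, ?_⟩ ⟨f, hf⟩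
  rintro _ ⟨g, rfl⟩
  have h1 := UB.abs_integral_le g.2 ξ
  have h2 := UB.abs_integral_le g.2 ξ'
  exact (abs_sub _ _).trans (by linarith)

lemma tvDist_le (ξ ξ' : Measure M) (a : ℝ)
    (h : ∀ f : M → ℝ, UB f → |∫ x, f x ∂ξ - ∫ x, f x ∂ξ'| ≤ a) : tvDist ξ ξ' ≤ a := by
  haveI : Nonempty {f : M → ℝ // Measurable f ∧ ∀ x, |f x| ≤ 1} :=
    ⟨⟨fun _ => 0, measurable_const, by simp⟩⟩
  exact ciSup_le fun f => h f.1 f.2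

lemma UB.ind {s : Set M} (hs : MeasurableSet s) : UB (s.indicator (fun _ => (1:ℝ))) := by
  refine ⟨measurable_const.indicator hs, fun x => ?_⟩
  by_cases h : x ∈ s <;> simp [h]

lemma ext_UB (ξ ξ' : Measure M) [IsProbabilityMeasure ξ] [IsProbabilityMeasure ξ']
    (h : ∀ f : M → ℝ, UB f → ∫ x, f x ∂ξ = ∫ x, f x ∂ξ') : ξ = ξ' := by
  ext s hs
  have := h _ (UB.ind hs)
  rw [integral_indicator_const _ hs, integral_indicator_const _ hs] at this
  simp only [smul_eq_mul, mul_one] at this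
  exact (measureReal_eq_measureReal_iff).1 this

/-- Completeness of probability measures in total variation (geometric Cauchy sequences). -/
lemma tv_complete (p : ℕ → Measure M) [∀ n, IsProbabilityMeasure (p n)] (A r : ℝ) (hA : 0 ≤ A)
    (hr0 : 0 < r) (hr1 : r < 1)
    (h : ∀ N n m, N ≤ n → N ≤ m → ∀ f : M → ℝ, UB f →
      |∫ x, f x ∂(p n) - ∫ x, f x ∂(p m)| ≤ A * r ^ N) :
    ∃ m : Measure M, IsProbabilityMeasure m ∧ ∀ f : M → ℝ, UB f →
      Tendsto (fun n => ∫ x, f x ∂(p n)) atTop (𝓝 (∫ x, f x ∂m)) := by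
  set ν := (Measure.sum p).toFinite with hν
  have hac : ∀ n, p n ≪ ν := fun n =>
    (Measure.absolutelyContinuous_sum_right n Measure.AbsolutelyContinuous.rfl).trans
      (absolutelyContinuous_toFinite _)
  set d : ℕ → M → ℝ := fun n x => ((p n).rnDeriv ν x).toReal with hd
  have hdm : ∀ n, Measurable (d n) := fun n => ((p n).measurable_rnDeriv ν).ennreal_toReal
  have hdi : ∀ n, Integrable (d n) ν := fun n => Measure.integrable_toReal_rnDeriv
  have hint : ∀ n (f : M → ℝ), ∫ x, d n x * f x ∂ν = ∫ x, f x ∂(p n) := fun n f =>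
    integral_toReal_rnDeriv_mul (hac n)
  have hmul : ∀ (g f : M → ℝ), Integrable g ν → UB f → Integrable (fun x => g x * f x) ν := by
    intro g f hg hf
    exact hg.mul_bdd hf.1.aestronglyMeasurable (ae_of_all _ hf.2)
  obtain ⟨dl, hdl, hlim⟩ := Lp.cauchy_complete_eLpNorm (μ := ν) (p := 1) le_rfl
    (f := d) (fun n => memLp_one_iff_integrable.2 (hdi n))
    (B := fun n => ENNReal.ofReal ((A + 1) * r ^ n)) (by
      exact ((summable_geometric_of_lt_one hr0.le hr1).mul_left (A+1)).tsum_ofReal_ne_top)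
    (by
      intro N n m hn hm
      have hi : Integrable (d n - d m) ν := (hdi n).sub (hdi m)
      rw [eLpNorm_one_eq_lintegral_enorm, ← ofReal_integral_norm_eq_lintegral_enorm hi]
      rw [ENNReal.ofReal_lt_ofReal_iff (by positivity)]
      set s := {x | d m x ≤ d n x}
      have hs : MeasurableSet s := measurableSet_le (hdm m) (hdm n)
      classical
      set f : M → ℝ := s.piecewise (fun _ => 1) (fun _ => -1) with hfdef
      have hf : UB f := by
        refine ⟨Measurable.piecewise hs measurable_const measurable_const, fun x => ?_⟩
        by_cases hx : x ∈ s <;> simp [hfdef, hx]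
      have h1 := h N n m hn hm f hf
      rw [← hint, ← hint, ← integral_sub (hmul _ _ (hdi n) hf) (hmul _ _ (hdi m) hf)] at h1
      have h2 : ∫ x, ‖(d n - d m) x‖ ∂ν = ∫ x, (d n x * f x - d m x * f x) ∂ν := by
        congr 1
        ext x
        by_cases hx : x ∈ s
        · have : d m x ≤ d n x := hx
          simp only [hfdef, Set.piecewise_eq_of_mem _ _ _ hx, Pi.sub_apply, Real.norm_eq_abs]
          rw [abs_of_nonneg (by linarith)]; ring
        · have : ¬ d m x ≤ d n x := hx
          simp only [hfdef, Set.piecewise_eq_of_notMem _ _ _ hx, Pi.sub_apply, Real.norm_eq_abs]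
          rw [abs_of_nonpos (by linarith)]; ring
      rw [h2]
      have := pow_pos hr0 N
      calc _ ≤ _ := le_abs_self _
        _ ≤ _ := h1
        _ < _ := by nlinarith)
  have hdli : Integrable dl ν := memLp_one_iff_integrable.1 hdl
  have hconv : ∀ f : M → ℝ, UB f →
      Tendsto (fun n => ∫ x, f x ∂(p n)) atTop (𝓝 (∫ x, dl x * f x ∂ν)) := by
    intro f hf
    simp_rw [← hint]
    refine tendsto_integral_of_L1 _ (hmul _ _ hdli hf).aestronglyMeasurable
      (Eventually.of_forall fun n => hmul _ _ (hdi n) hf) ?_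
    refine tendsto_of_tendsto_of_tendsto_of_le_of_le tendsto_const_nhds hlim
      (fun _ => zero_le) (fun n => ?_)
    simp only [eLpNorm_one_eq_lintegral_enorm]
    refine lintegral_mono fun x => ?_
    rw [← sub_mul, enorm_mul]
    have : ‖f x‖ₑ ≤ 1 := by
      rw [← ofReal_norm_eq_enorm]; simpa using hf.2 x
    calc _ ≤ ‖d n x - dl x‖ₑ * 1 := by gcongr
      _ = _ := by simp
  have hnn : 0 ≤ᵐ[ν] dl := by
    refine ae_nonneg_of_forall_setIntegral_nonneg hdli fun s hs _ => ?_
    have h1 := hconv _ (UB.ind hs)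
    have h2 : ∫ x, dl x * s.indicator (fun _ => (1:ℝ)) x ∂ν = ∫ x in s, dl x ∂ν := by
      rw [← integral_indicator hs]
      congr 1; ext x
      by_cases hx : x ∈ s <;> simp [hx]
    rw [← h2]
    exact ge_of_tendsto' h1 fun n => integral_nonneg fun x => by
      by_cases hx : x ∈ s <;> simp [hx]
  set m := ν.withDensity (fun x => ENNReal.ofReal (dl x)) with hm
  have hmint : ∀ f : M → ℝ, ∫ x, f x ∂m = ∫ x, dl x * f x ∂ν := by
    intro f
    rw [hm, integral_withDensity_eq_integral_toReal_smul₀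
      hdli.aestronglyMeasurable.aemeasurable.ennreal_ofReal (by simp)]
    refine integral_congr_ae ?_
    filter_upwards [hnn] with x hx
    simp [ENNReal.toReal_ofReal hx]
  have h1 : UB (fun _ : M => (1:ℝ)) := ⟨measurable_const, by simp⟩
  have hprob : IsProbabilityMeasure m := by
    constructor
    have h2 := hconv _ h1
    rw [← hmint] at h2
    simp only [integral_const, probReal_univ, smul_eq_mul, mul_one] at h2
    have h3 := tendsto_nhds_unique h2 tendsto_const_nhds
    exact (ENNReal.toReal_eq_one_iff _).1 h3
  refine ⟨m, hprob, fun f hf => ?_⟩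
  rw [hmint]; exact hconv f hf

/-- A kernel with geometrically contracting oscillations is geometrically ergodic. -/
lemma ergodic_of_contract [Nonempty M] (Q : Kernel M M) [IsMarkovKernel Q] (A r : ℝ) (hA : 0 ≤ A)
    (hr0 : 0 < r) (hr1 : r < 1)
    (h : ∀ (n : ℕ) (f : M → ℝ), UB f → ∀ x y, |(opT Q)^[n] f x - (opT Q)^[n] f y| ≤ A * r ^ n) :
    ∃ m : Measure M, IsProbabilityMeasure m ∧ m.bind Q = m ∧
      (∀ μ' : Measure M, IsProbabilityMeasure μ' → μ'.bind Q = μ' → μ' = m) ∧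
      ∀ (n : ℕ) (x : M), tvDist (iterateK Q (Measure.dirac x) n) m ≤ A * r ^ n := by
  obtain ⟨x0⟩ := ‹Nonempty M›
  have hz : Tendsto (fun n : ℕ => A * r ^ n) atTop (𝓝 0) := by
    simpa using (tendsto_pow_atTop_nhds_zero_of_lt_one hr0.le hr1).const_mul A
  obtain ⟨m, hm, hlim⟩ := tv_complete (fun n => iterateK Q (Measure.dirac x0) n) A r hA hr0 hr1 (by
    intro N n n' hn hn' f hf
    have key : ∀ k, N ≤ k → ∫ x, f x ∂(iterateK Q (Measure.dirac x0) k) =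
        ∫ x, (opT Q)^[N] f x ∂(iterateK Q (Measure.dirac x0) (k - N)) := by
      intro k hk
      rw [integral_iterateK_dirac hf, integral_iterateK_dirac (hf.iter Q N),
        ← Function.iterate_add_apply, Nat.sub_add_cancel hk]
    rw [key n hn, key n' hn']
    exact abs_integral_sub_integral_le _ _ ((hf.iter Q N).integrable _)
      ((hf.iter Q N).integrable _) _ (h N f hf))
  have hinv : m.bind Q = m := by
    refine ext_UB _ _ fun f hf => ?_
    rw [integral_bind_opT hf]
    refine tendsto_nhds_unique (hlim _ (hf.opT Q)) ?_
    have h2 := (tendsto_add_atTop_iff_nat 1).2 (hlim f hf)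
    refine h2.congr fun n => ?_
    rw [iterateK, integral_bind_opT hf]
  refine ⟨m, hm, hinv, fun μ' hμ' hi => ?_, fun n x => ?_⟩
  · refine ext_UB _ _ fun f hf => ?_
    have hb : ∀ n : ℕ, |∫ x, f x ∂μ' - ∫ x, f x ∂m| ≤ A * r ^ n := by
      intro n
      rw [← integral_inv_iter hf μ' Q hi n, ← integral_inv_iter hf m Q hinv n]
      exact abs_integral_sub_integral_le _ _ ((hf.iter Q n).integrable _)
        ((hf.iter Q n).integrable _) _ (h n f hf)
    have := ge_of_tendsto' hz hb
    exact sub_eq_zero.1 (abs_nonpos_iff.1 this)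
  · refine tvDist_le _ _ _ fun f hf => ?_
    rw [integral_iterateK_dirac hf, ← integral_inv_iter hf m Q hinv n, abs_sub_comm]
    exact abs_integral_sub_le _ ((hf.iter Q n).integrable _) _ _ fun y => h n f hf y x

lemma opT_iter_affine (Q : Kernel M M) [IsMarkovKernel Q] (c a : ℝ) (n : ℕ) {h : M → ℝ}
    (hh : UB h) : (opT Q)^[n] (fun x => c + a * h x) = fun x => c + a * (opT Q)^[n] h x := by
  induction n with
  | zero => rfl
  | succ n ih =>
    rw [Function.iterate_succ_apply', ih, Function.iterate_succ_apply']
    ext x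
    have hi := (hh.iter Q n).integrable (Q x)
    simp only [opT]
    rw [integral_add (integrable_const c) (hi.const_mul a), integral_const_mul]
    simp [opT]

/-- One-block contraction gives geometric contraction along blocks. -/
lemma block_contract [Nonempty M] (Q : Kernel M M) [IsMarkovKernel Q] (N : ℕ) (ρ : ℝ) (hρ : 0 < ρ)
    (h : ∀ f : M → ℝ, UB f → ∀ x y, |(opT Q)^[N] f x - (opT Q)^[N] f y| ≤ ρ) (q : ℕ)
    (f : M → ℝ) (hf : UB f) (x y : M) :
    |(opT Q)^[N * q] f x - (opT Q)^[N * q] f y| ≤ 2 * ρ ^ q := by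
  obtain ⟨x0⟩ := ‹Nonempty M›
  induction q generalizing x y with
  | zero =>
    have h1 := hf.2 x
    have h2 := hf.2 y
    simpa using (abs_sub _ _).trans (by linarith)
  | succ q ih =>
    have hpos : 0 < 2 * ρ ^ q := by positivity
    set a := 2 * ρ ^ q with ha
    set g := (opT Q)^[N * q] f with hg
    have hgu : UB g := hf.iter Q _
    set k : M → ℝ := fun x => (g x - g x0) / a with hk
    have hku : UB k := by
      refine ⟨(hgu.1.sub_const _).div_const _, fun x => ?_⟩
      rw [hk, abs_div, abs_of_pos hpos, div_le_one hpos]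
      exact ih x x0
    have hgk : g = fun x => g x0 + a * k x := by
      ext x; simp only [hk]; field_simp; ring
    have he : (opT Q)^[N * (q + 1)] f = fun x => g x0 + a * (opT Q)^[N] k x := by
      rw [mul_add, mul_one, add_comm, Function.iterate_add_apply, ← hg, hgk,
        opT_iter_affine Q _ _ N hku]
      simp [hk]
    rw [he]
    have := h k hku x y
    have h3 : g x0 + a * (opT Q)^[N] k x - (g x0 + a * (opT Q)^[N] k y)
      = a * ((opT Q)^[N] k x - (opT Q)^[N] k y) := by ring
    simp only [h3]
    rw [abs_mul, abs_of_pos hpos, pow_succ]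
    calc _ ≤ a * ρ := by gcongr
      _ = _ := by rw [ha]; ring

lemma iter_approx (P Q : Kernel M M) [IsMarkovKernel P] [IsMarkovKernel Q] (η : ℝ)
    (h : ∀ f : M → ℝ, UB f → ∀ x, |opT Q f x - opT P f x| ≤ η) (n : ℕ) (f : M → ℝ) (hf : UB f)
    (x : M) : |(opT Q)^[n] f x - (opT P)^[n] f x| ≤ n * η := by
  induction n generalizing x with
  | zero => simp
  | succ n ih =>
    rw [Function.iterate_succ_apply', Function.iterate_succ_apply']
    have h1 := h _ (hf.iter Q n) x
    have h2 : |opT P ((opT Q)^[n] f) x - opT P ((opT P)^[n] f) x| ≤ n * η := by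
      have hi1 := (hf.iter Q n).integrable (P x)
      have hi2 := (hf.iter P n).integrable (P x)
      have := abs_integral_sub_le (P x) (hi1.sub hi2) 0 (n * η) (by simpa using ih)
      simp only [opT]
      rw [← integral_sub hi1 hi2]
      simpa using this
    calc _ ≤ _ := abs_sub_le _ (opT P ((opT Q)^[n] f) x) _
      _ ≤ _ := add_le_add h1 h2
      _ = _ := by push_cast; ring

end helpers

/-- **Stability of invariant measures under kernel perturbation.**  Let `K` be
geometrically ergodic with rate `κ ∈ (0,1)` and unique invariant probability measure
`μ`, and let `{K_ε}` be a family of Markov kernels with `K_0 = K` and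
`sup_{|f|≤1} ‖K_ε f − K f‖_∞ → 0` as `ε → 0`.  Then for each `κ̂ ∈ (κ,1)` there is
`δ > 0` such that each `K_ε`, `0 ≤ ε < δ`, has a unique invariant probability measure
`μ_ε`, with `sup_{ε<δ} sup_x ‖δ_x K_ε^n − μ_ε‖_TV = O(κ̂^n)` and
`‖μ_ε − μ‖_TV → 0` as `ε → 0`. -/
theorem kernel_perturbation_stability
    {M : Type*} [MeasurableSpace M]
    (K : Kernel M M) [IsMarkovKernel K]
    (μ : Measure M) [IsProbabilityMeasure μ] (hinv : μ.bind K = μ)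
    (huniq : ∀ μ' : Measure M, IsProbabilityMeasure μ' → μ'.bind K = μ' → μ' = μ)
    (κ : ℝ) (hκ0 : 0 < κ) (hκ1 : κ < 1)
    (hgeo : ∃ C : ℝ, ∀ (n : ℕ) (x : M),
      tvDist (iterateK K (Measure.dirac x) n) μ ≤ C * κ ^ n)
    (Keps : ℝ → Kernel M M) [∀ ε, IsMarkovKernel (Keps ε)]
    (hK0 : Keps 0 = K)
    -- sup_{|f| ≤ 1} ‖K_ε f − K f‖_∞ → 0 as ε → 0
    (happrox : ∀ η > (0 : ℝ), ∃ δ > (0 : ℝ), ∀ ε : ℝ, 0 ≤ ε → ε < δ →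
      ∀ f : M → ℝ, Measurable f → (∀ x, |f x| ≤ 1) →
        ∀ x : M, |∫ y, f y ∂(Keps ε x) - ∫ y, f y ∂(K x)| ≤ η) :
    ∀ κh : ℝ, κ < κh → κh < 1 →
      ∃ δ > (0 : ℝ), ∃ μe : ℝ → Measure M,
        (∀ ε : ℝ, 0 ≤ ε → ε < δ →
          IsProbabilityMeasure (μe ε) ∧ (μe ε).bind (Keps ε) = μe ε ∧
          (∀ μ' : Measure M, IsProbabilityMeasure μ' → μ'.bind (Keps ε) = μ' →
            μ' = μe ε)) ∧
        (∃ C : ℝ, ∀ ε : ℝ, 0 ≤ ε → ε < δ → ∀ (n : ℕ) (x : M),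
          tvDist (iterateK (Keps ε) (Measure.dirac x) n) (μe ε) ≤ C * κh ^ n) ∧
        (∀ η > (0 : ℝ), ∃ δ' > (0 : ℝ), ∀ ε : ℝ, 0 ≤ ε → ε < min δ δ' →
          tvDist (μe ε) μ ≤ η) := by
  intro κh hκh hκh1
  have hκhp : 0 < κh := hκ0.trans hκh
  obtain ⟨C, hC⟩ := hgeo
  haveI hne : Nonempty M := μ.nonempty_of_neZero
  have hTC : ∀ (n : ℕ) (f : M → ℝ), UB f → ∀ x,
      |(opT K)^[n] f x - ∫ y, f y ∂μ| ≤ C * κ ^ n := by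
    intro n f hf x
    rw [← integral_iterateK_dirac hf]
    exact (le_tvDist _ _ hf).trans (hC n x)
  -- choose the block length
  have hratio : Tendsto (fun n : ℕ => 2 * C * (κ / κh) ^ n) atTop (𝓝 0) := by
    simpa using (tendsto_pow_atTop_nhds_zero_of_lt_one (by positivity)
      ((div_lt_one hκhp).2 hκh)).const_mul (2 * C)
  obtain ⟨N, hN, hN1⟩ := ((hratio.eventually_lt_const (u := 1 / 2) (by norm_num)).and
    (eventually_ge_atTop 1)).exists
  have hpN : 0 < κh ^ N := pow_pos hκhp N
  have hCN : 2 * C * κ ^ N ≤ κh ^ N / 2 := by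
    rw [div_pow, ← mul_div_assoc, div_lt_iff₀ hpN] at hN
    linarith
  have hN0 : (0 : ℝ) < N := by exact_mod_cast hN1
  obtain ⟨δ, hδ, happ⟩ := happrox (κh ^ N / (4 * N)) (by positivity)
  set A : ℝ := 2 * (κh ^ N)⁻¹ with hA
  have hA0 : 0 ≤ A := by positivity
  have hcontract : ∀ ε : ℝ, 0 ≤ ε → ε < δ → ∀ (n : ℕ) (f : M → ℝ), UB f → ∀ x y,
      |(opT (Keps ε))^[n] f x - (opT (Keps ε))^[n] f y| ≤ A * κh ^ n := by
    intro ε h0 h1 n f hf x y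
    have hblock : ∀ f : M → ℝ, UB f → ∀ x y,
        |(opT (Keps ε))^[N] f x - (opT (Keps ε))^[N] f y| ≤ κh ^ N := by
      intro f hf x y
      have hap := iter_approx K (Keps ε) (κh ^ N / (4 * N))
        (fun f hf x => happ ε h0 h1 f hf.1 hf.2 x) N f hf
      have e : (N : ℝ) * (κh ^ N / (4 * N)) = κh ^ N / 4 := by field_simp
      rw [e] at hap
      have a1 := abs_le.1 (hap x)
      have a2 := abs_le.1 (hap y)
      have a3 := abs_le.1 (hTC N f hf x)
      have a4 := abs_le.1 (hTC N f hf y)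
      rw [abs_le]; constructor <;> linarith [a1.1, a1.2, a2.1, a2.2, a3.1, a3.2, a4.1, a4.2]
    have hb := block_contract (Keps ε) N (κh ^ N) hpN hblock (n / N)
      ((opT (Keps ε))^[n % N] f) (hf.iter _ _) x y
    rw [← Function.iterate_add_apply, Nat.div_add_mod] at hb
    refine hb.trans ?_
    have hmod : κh ^ N ≤ κh ^ (n % N) :=
      pow_le_pow_of_le_one hκhp.le hκh1.le (Nat.mod_lt _ hN1).le
    have hsplit : κh ^ n = κh ^ (N * (n / N)) * κh ^ (n % N) := by
      rw [← pow_add, Nat.div_add_mod]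
    rw [hsplit, ← pow_mul, hA]
    have hq : 0 < κh ^ (N * (n / N)) := pow_pos hκhp _
    have : 1 ≤ (κh ^ N)⁻¹ * κh ^ (n % N) := by
      rw [inv_mul_eq_div, one_le_div hpN]; exact hmod
    nlinarith
  have hex : ∀ ε : ℝ, ∃ m : Measure M, 0 ≤ ε → ε < δ → IsProbabilityMeasure m ∧
      m.bind (Keps ε) = m ∧
      (∀ μ' : Measure M, IsProbabilityMeasure μ' → μ'.bind (Keps ε) = μ' → μ' = m) ∧
      ∀ (n : ℕ) (x : M), tvDist (iterateK (Keps ε) (Measure.dirac x) n) m ≤ A * κh ^ n := by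
    intro ε
    by_cases hε : 0 ≤ ε ∧ ε < δ
    · obtain ⟨m, hm⟩ := ergodic_of_contract (Keps ε) A κh hA0 hκhp hκh1
        (hcontract ε hε.1 hε.2)
      exact ⟨m, fun _ _ => hm⟩
    · exact ⟨0, fun h0 h1 => absurd ⟨h0, h1⟩ hε⟩
  choose μe hμe using hex
  refine ⟨δ, hδ, μe, fun ε h0 h1 => ?_, ⟨A, fun ε h0 h1 => (hμe ε h0 h1).2.2.2⟩, ?_⟩
  · obtain ⟨a, b, c, -⟩ := hμe ε h0 h1
    exact ⟨a, b, c⟩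
  intro η hη
  have hz : Tendsto (fun n : ℕ => C * κ ^ n) atTop (𝓝 0) := by
    simpa using (tendsto_pow_atTop_nhds_zero_of_lt_one hκ0.le hκ1).const_mul C
  obtain ⟨n, hn⟩ := (hz.eventually_lt_const (u := η / 2) (by positivity)).exists
  obtain ⟨δ', hδ', happ'⟩ := happrox (η / (2 * (n + 1))) (by positivity)
  refine ⟨δ', hδ', fun ε h0 h1 => ?_⟩
  obtain ⟨hp, hi, -, -⟩ := hμe ε h0 (h1.trans_le (min_le_left _ _))
  refine tvDist_le _ _ _ fun f hf => ?_
  rw [← integral_inv_iter hf (μe ε) (Keps ε) hi n]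
  refine abs_integral_sub_le _ ((hf.iter _ n).integrable _) _ _ fun x => ?_
  have b1 := iter_approx K (Keps ε) (η / (2 * (n + 1)))
    (fun f hf x => happ' ε h0 (h1.trans_le (min_le_right _ _)) f hf.1 hf.2 x) n f hf x
  have b2 := hTC n f hf x
  have b3 : (n : ℝ) * (η / (2 * (n + 1))) ≤ η / 2 := by
    rw [← mul_div_assoc, div_le_div_iff₀ (by positivity) (by norm_num)]
    nlinarith
  calc _ ≤ _ := abs_sub_le _ ((opT K)^[n] f x) _
    _ ≤ η := by linarith
end

section
/- (Invariance check off the restart set.) In the source-sink chain, for every measurable C with C ∩ R = ∅ (so ρ(C) = 0 implies P^ρ(J_0 ∈ C) = 0), the measure ν(·) := Σ_{n=0}^∞ P^ρ(J_n ∈ ·, σ_P ≥ n) satisfies ∫_M ν(dx) K(x, C) = ν(C), using that J_{n+1} ∉ R implies σ_P ≠ n (since the chain is in R at time n+1 only if it restarted, i.e., hit P at time n). -/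
open MeasureTheory ProbabilityTheory Filter Set

/-- Killed iterates: `killedSeq K P ρ n C = P^ρ(J_n ∈ C, σ_P ≥ n)`, so that
`Measure.sum (killedSeq K P ρ) = ν(⬝) = Σ_n P^ρ(J_n ∈ ⬝, σ_P ≥ n)`. -/
noncomputable def killedSeq {M : Type*} [MeasurableSpace M]
    (K : ProbabilityTheory.Kernel M M) (P : Set M) (ξ : Measure M) : ℕ → Measure M
  | 0 => ξ
  | n + 1 => ((killedSeq K P ξ n).restrict Pᶜ).bind K

/-- **Invariance check off the restart set.**  For the source-sink chain (restart at
`ρ` upon hitting `P`, with `ρ` supported on `R`, `R ∩ P = ∅`, and `E^ρ[σ_P] < ∞`), the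
measure `ν(⬝) = Σ_n P^ρ(J_n ∈ ⬝, σ_P ≥ n)` satisfies, for every measurable `C` with
`C ∩ R = ∅`: `∫_M ν(dx) K(x, C) = ν(C)`. -/
theorem invariance_off_restart_set
    {M : Type*} [MeasurableSpace M] [StandardBorelSpace M]
    (K : Kernel M M) [IsMarkovKernel K]
    (P R : Set M) (hP : MeasurableSet P) (hR : MeasurableSet R)
    (hRP : R ∩ P = ∅)
    (ρ : Measure M) [IsProbabilityMeasure ρ]
    (hρR : ρ Rᶜ = 0)  -- ρ is supported on R
    (hrestart : ∀ x ∈ P, K x = ρ)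
    (hfin : Measure.sum (killedSeq K P ρ) Set.univ ≠ ⊤) :
    ∀ C : Set M, MeasurableSet C → C ∩ R = ∅ →
      ∫⁻ x, K x C ∂(Measure.sum (killedSeq K P ρ))
        = (Measure.sum (killedSeq K P ρ)) C := by
  intro C hC hCR
  have hρC : ρ C = 0 := by
    refine measure_mono_null (t := Rᶜ) ?_ hρR
    intro x hx hxR
    have : x ∈ C ∩ R := ⟨hx, hxR⟩
    simp [hCR] at this
  have hstep : ∀ n, ∫⁻ x, K x C ∂(killedSeq K P ρ n) = killedSeq K P ρ (n + 1) C := by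
    intro n
    rw [killedSeq, Measure.bind_apply hC K.measurable.aemeasurable,
      ← lintegral_add_compl (fun x => K x C) hP,
      setLIntegral_congr_fun (g := fun _ => 0) hP (fun x hx => by simp [hrestart x hx, hρC])]
    simp
  rw [lintegral_sum_measure, Measure.sum_apply _ hC,
    tsum_eq_zero_add' (f := fun n => killedSeq K P ρ n C) ENNReal.summable]
  simp only [hstep]
  rw [show killedSeq K P ρ 0 C = 0 from hρC, zero_add]
end
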